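/- arXiv:2507.01144 — 2 statements merged into one kernel-verified Lean document; each statement's English description precedes it below -/
import Mathlib

section
/- Assume conditions (A2)–(A4). Then lim_{t→∞} E_μ[I_t(g)²]/t = 2∫_X g χ_g dμ_*. -/
open MeasureTheory Filter Set
open scoped ENNReal Topology NNReal

noncomputable section

variable {X : Type*} [MetricSpace X] [CompleteSpace X] [SecondCountableTopology X]
  [MeasurableSpace X] [BorelSpace X]

/-- Action of a transition kernel family on measures: `ν ↦ ν P_t`. -/
def measAct (P : ℝ → X → Measure X) (t : ℝ) (ν : Measure X) : Measure X :=
  ν.bind (P t)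

/-- Dual action of the semigroup on functions: `f ↦ P_t f`. -/
def funAct (P : ℝ → X → Measure X) (t : ℝ) (f : X → ℝ) (x : X) : ℝ :=
  ∫ y, f y ∂(P t x)

/-- A Borel (probability) measure has a finite first moment. -/
def FiniteFirstMoment (ν : Measure X) : Prop :=
  ∀ x₀ : X, Integrable (fun x => dist x₀ x) ν

/-- The Wasserstein (Kantorovich–Rubinstein) distance `d_W`. -/
def wassDist (μ ν : Measure X) : ℝ :=
  sSup {r | ∃ f : X → ℝ, LipschitzWith 1 f ∧ r = |(∫ x, f x ∂μ) - ∫ x, f x ∂ν|}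

/-- A Markov semigroup `{P_t}_{t ≥ 0}` of probability kernels on `X`. -/
structure IsMarkovSemigroup (P : ℝ → X → Measure X) : Prop where
  prob : ∀ t, 0 ≤ t → ∀ x, IsProbabilityMeasure (P t x)
  jointMeas : ∀ A : Set X, MeasurableSet A → Measurable fun p : ℝ × X => P p.1 p.2 A
  init : ∀ x, P 0 x = Measure.dirac x
  chapman : ∀ s t, 0 ≤ s → 0 ≤ t → ∀ x, P (s + t) x = (P s x).bind (P t)

/-- Condition (A1): stochastic continuity of the semigroup. -/
def CondA1 (P : ℝ → X → Measure X) : Prop :=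
  ∀ f : X → ℝ, Continuous f → (∃ C, ∀ x, |f x| ≤ C) →
    ∀ x : X, Tendsto (fun t => funAct P t f x) (𝓝[>] (0 : ℝ)) (𝓝 (f x))

/-- Condition (A2): the Feller property. -/
def CondA2 (P : ℝ → X → Measure X) : Prop :=
  ∀ f : X → ℝ, Continuous f → (∃ C, ∀ x, |f x| ≤ C) → ∀ t, 0 ≤ t →
    Continuous (funAct P t f) ∧ ∃ C, ∀ x, |funAct P t f x| ≤ C

/-- Condition (A3): preservation of finite first moments and exponential
contractivity in the Wasserstein distance, with rate `γ`. -/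
def CondA3 (P : ℝ → X → Measure X) (γ : ℝ) : Prop :=
  (∀ ν : Measure X, IsProbabilityMeasure ν → FiniteFirstMoment ν →
    ∀ t, 0 < t → FiniteFirstMoment (measAct P t ν)) ∧
  0 < γ ∧
  ∀ t, 0 ≤ t → ∀ x y : X,
    wassDist (P t x) (P t y) ≤ Real.exp (-γ * t) * dist x y

/-- Condition (A4): a uniform-in-time moment bound of order `ζ > 2` for the initial
distribution `μ`, along the semigroup. -/
def CondA4 (P : ℝ → X → Measure X) (μ : Measure X) (x₀ : X) (ζ : ℝ) : Prop :=
  2 < ζ ∧ ∃ M : ℝ, ∀ t, 0 ≤ t →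
    (∫⁻ x, ENNReal.ofReal (dist x₀ x ^ ζ) ∂(measAct P t μ)) ≤ ENNReal.ofReal M

variable {Ω : Type*} [MeasurableSpace Ω]

/-- The natural filtration of the process `Φ`. -/
def natFiltration (Φ : ℝ → Ω → X) (s : ℝ) : MeasurableSpace Ω :=
  ⨆ u ∈ Set.Icc (0 : ℝ) s, MeasurableSpace.comap (Φ u) inferInstance

/-- A (progressively measurable) time-homogeneous Markov process with state space `X`,
transition semigroup `P` and initial distribution `μ`, realized on `(Ω, ℙ)`. -/
structure IsMarkovProcess (P : ℝ → X → Measure X) (Φ : ℝ → Ω → X)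
    (ℙ : Measure Ω) (μ : Measure X) : Prop where
  jointMeas : Measurable fun p : ℝ × Ω => Φ p.1 p.2
  init : ℙ.map (Φ 0) = μ
  law : ∀ t, 0 ≤ t → ℙ.map (Φ t) = measAct P t μ
  markov : ∀ f : X → ℝ, Measurable f → (∃ C, ∀ x, |f x| ≤ C) →
    ∀ s t : ℝ, 0 ≤ s → 0 ≤ t →
      (fun ω => funAct P t f (Φ s ω)) =ᵐ[ℙ]
        ℙ[(fun ω => f (Φ (s + t) ω)) | natFiltration Φ s]

/-- A Markov process together with a measurable family of laws `{ℙ_x}_{x ∈ X}`,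
with `ℙ_x(Φ_0 = x) = 1`. -/
structure IsMarkovFamily (P : ℝ → X → Measure X) (Φ : ℝ → Ω → X)
    (ℙ : X → Measure Ω) : Prop where
  prob : ∀ x, IsProbabilityMeasure (ℙ x)
  jointMeas : Measurable fun p : ℝ × Ω => Φ p.1 p.2
  measFam : ∀ s : Set Ω, MeasurableSet s → Measurable fun x => ℙ x s
  start : ∀ x, (ℙ x) {ω | Φ 0 ω = x} = 1
  law : ∀ x, ∀ t, 0 ≤ t → (ℙ x).map (Φ t) = P t x
  markov : ∀ x : X, ∀ f : X → ℝ, Measurable f → (∃ C, ∀ z, |f z| ≤ C) →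
    ∀ s t : ℝ, 0 ≤ s → 0 ≤ t →
      (fun ω => funAct P t f (Φ s ω)) =ᵐ[ℙ x]
        (ℙ x)[(fun ω => f (Φ (s + t) ω)) | natFiltration Φ s]

/-- The corrector function `χ_g(x) = ∫_0^∞ (P_t g)(x) dt`. -/
def corrector (P : ℝ → X → Measure X) (g : X → ℝ) (x : X) : ℝ :=
  ∫ t in Set.Ioi (0 : ℝ), funAct P t g x

/-- The additive functional `I_t(g) = ∫_0^t g(Φ_s) ds`. -/
def addFun (g : X → ℝ) (Φ : ℝ → Ω → X) (t : ℝ) (ω : Ω) : ℝ :=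
  ∫ s in (0 : ℝ)..t, g (Φ s ω)

/-- The martingale part `M_t(g) = χ_g(Φ_t) - χ_g(Φ_0) + I_t(g)`. -/
def mart (P : ℝ → X → Measure X) (g : X → ℝ) (Φ : ℝ → Ω → X) (t : ℝ) (ω : Ω) : ℝ :=
  corrector P g (Φ t ω) - corrector P g (Φ 0 ω) + addFun g Φ t ω

/-- The martingale increments `Z_n(g) = M_n(g) - M_{n-1}(g)`. -/
def incr (P : ℝ → X → Measure X) (g : X → ℝ) (Φ : ℝ → Ω → X) (n : ℕ) (ω : Ω) : ℝ :=
  mart P g Φ (n : ℝ) ω - mart P g Φ ((n : ℝ) - 1) ω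

/-- Truncation `a ∧ p` for `p ∈ ℕ ∪ {∞}`, with the convention `a ∧ ∞ = a`. -/
def truncMin (a : ℝ) (p : ℕ∞) : ℝ :=
  if p = ⊤ then a else min a (p.toNat : ℝ)

section aux

lemma aux_meas {P : ℝ → X → Measure X} (hP : IsMarkovSemigroup P) :
    Measurable (fun p : ℝ × X => P p.1 p.2) :=
  Measure.measurable_of_measurable_coe _ hP.jointMeas

lemma aux_meas_t {P : ℝ → X → Measure X} (hP : IsMarkovSemigroup P) (t : ℝ) :
    Measurable (P t) :=
  (aux_meas hP).comp (measurable_const.prodMk measurable_id)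

lemma aux_funAct_joint {P : ℝ → X → Measure X} (hP : IsMarkovSemigroup P) {f : X → ℝ}
    (hf : Measurable f) : Measurable (fun p : ℝ × X => funAct P p.1 f p.2) := by
  let κ : ProbabilityTheory.Kernel (ℝ × X) X := ⟨fun p => P p.1 p.2, aux_meas hP⟩
  exact (MeasureTheory.StronglyMeasurable.integral_kernel (κ := κ)
    hf.stronglyMeasurable).measurable

lemma aux_funAct_meas {P : ℝ → X → Measure X} (hP : IsMarkovSemigroup P) {f : X → ℝ}
    (hf : Measurable f) (t : ℝ) : Measurable (funAct P t f) :=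
  (aux_funAct_joint hP hf).comp (measurable_const.prodMk measurable_id)

lemma aux_prob {P : ℝ → X → Measure X} (hP : IsMarkovSemigroup P) (ν : Measure X)
    [IsProbabilityMeasure ν] {t : ℝ} (ht : 0 ≤ t) : IsProbabilityMeasure (measAct P t ν) := by
  constructor
  rw [measAct, Measure.bind_apply MeasurableSet.univ (aux_meas_t hP t).aemeasurable]
  have := hP.prob t ht
  simp

lemma aux_integrable_bdd {Y : Type*} [MeasurableSpace Y] (ν : Measure Y) [IsFiniteMeasure ν]
    {f : Y → ℝ} (hf : Measurable f) {C : ℝ} (hC : ∀ x, |f x| ≤ C) : Integrable f ν :=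
  Integrable.of_bound hf.aestronglyMeasurable C (Eventually.of_forall hC)

lemma aux_integral_measAct {P : ℝ → X → Measure X} (hP : IsMarkovSemigroup P) (ν : Measure X)
    [IsProbabilityMeasure ν] {t : ℝ} (ht : 0 ≤ t) {f : X → ℝ} (hf : Measurable f)
    {C : ℝ} (hC : ∀ x, |f x| ≤ C) :
    ∫ x, f x ∂(measAct P t ν) = ∫ x, funAct P t f x ∂ν := by
  let κ : ProbabilityTheory.Kernel X X := ⟨P t, aux_meas_t hP t⟩
  have := aux_prob hP ν ht
  have hi : Integrable f (measAct P t ν) := aux_integrable_bdd _ hf hC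
  have e : measAct P t ν = ν.bind κ := rfl
  rw [e] at hi ⊢
  rw [Measure.comp_eq_comp_const_apply] at hi ⊢
  rw [ProbabilityTheory.Kernel.integral_comp hi]
  rfl

lemma aux_funAct_bdd {P : ℝ → X → Measure X} (hP : IsMarkovSemigroup P) {t : ℝ} (ht : 0 ≤ t)
    {f : X → ℝ} {C : ℝ} (hC : ∀ x, |f x| ≤ C) (x : X) : |funAct P t f x| ≤ C := by
  have := hP.prob t ht x
  have := norm_integral_le_of_norm_le_const (μ := P t x) (f := f) (C := C)
    (Eventually.of_forall hC)
  simpa [funAct] using this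

lemma aux_ffm {P : ℝ → X → Measure X} (hP : IsMarkovSemigroup P) {γ : ℝ} (hA3 : CondA3 P γ)
    {t : ℝ} (ht : 0 ≤ t) (x : X) : FiniteFirstMoment (P t x) := by
  have hd : ∀ x : X, FiniteFirstMoment (Measure.dirac x) := by
    intro x y
    exact integrable_dirac (by simp)
  rcases ht.eq_or_lt with rfl | h
  · rw [hP.init]; exact hd x
  · have := hA3.1 (Measure.dirac x) inferInstance (hd x) t h
    rwa [measAct, Measure.dirac_bind (aux_meas_t hP t)] at this

/-- contraction for 1-Lipschitz functions -/
lemma aux_contr1 {P : ℝ → X → Measure X} (hP : IsMarkovSemigroup P) {γ : ℝ} (hA3 : CondA3 P γ)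
    {t : ℝ} (ht : 0 ≤ t) {f : X → ℝ} (hf : LipschitzWith 1 f) (x y : X) :
    |funAct P t f x - funAct P t f y| ≤ Real.exp (-γ * t) * dist x y := by
  refine le_trans ?_ (hA3.2.2 t ht x y)
  unfold wassDist
  refine le_csSup ?_ ⟨f, hf, rfl⟩
  have hx := aux_ffm hP hA3 ht x x
  have hy := aux_ffm hP hA3 ht y x
  have := hP.prob t ht x
  have := hP.prob t ht y
  refine ⟨(∫ z, dist x z ∂(P t x)) + ∫ z, dist x z ∂(P t y), ?_⟩
  rintro r ⟨h, hh, rfl⟩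
  have key : ∀ ν : Measure X, IsProbabilityMeasure ν → Integrable (fun z => dist x z) ν →
      |(∫ z, h z ∂ν) - h x| ≤ ∫ z, dist x z ∂ν := by
    intro ν _ hν
    have hb : ∀ z, ‖h z - h x‖ ≤ dist x z := by
      intro z
      have := hh.dist_le_mul z x
      rw [Real.dist_eq, dist_comm z x] at this
      simpa using this
    have hi : Integrable (fun z => h z - h x) ν :=
      hν.mono' (hh.continuous.measurable.sub_const _).aestronglyMeasurable
        (Eventually.of_forall hb)
    have hi2 : Integrable h ν := by
      have h5 := hi.add (integrable_const (h x))
      refine h5.congr (Eventually.of_forall fun z => ?_)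
      simp
    have e : (∫ z, h z ∂ν) - h x = ∫ z, (h z - h x) ∂ν := by
      rw [integral_sub hi2 (integrable_const _)]; simp
    rw [e]
    exact norm_integral_le_of_norm_le hν (Eventually.of_forall hb)
  have h1 := key (P t x) inferInstance hx
  have h2 := key (P t y) inferInstance hy
  rw [abs_le] at h1 h2 ⊢
  constructor <;> linarith [h1.1, h1.2, h2.1, h2.2]

lemma aux_contr {P : ℝ → X → Measure X} (hP : IsMarkovSemigroup P) {γ : ℝ} (hA3 : CondA3 P γ)
    {t : ℝ} (ht : 0 ≤ t) {f : X → ℝ} {L : ℝ} (hL : 0 < L)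
    (hf : ∀ x y, |f x - f y| ≤ L * dist x y) (x y : X) :
    |funAct P t f x - funAct P t f y| ≤ L * Real.exp (-γ * t) * dist x y := by
  have h1 : LipschitzWith 1 (fun z => L⁻¹ * f z) := by
    apply LipschitzWith.of_dist_le_mul
    intro z w
    rw [Real.dist_eq, ← mul_sub, abs_mul, abs_of_pos (inv_pos.2 hL)]
    have := mul_le_mul_of_nonneg_left (hf z w) (inv_pos.2 hL).le
    rw [← mul_assoc, inv_mul_cancel₀ hL.ne'] at this
    simpa using this
  have h2 := aux_contr1 hP hA3 ht h1 x y
  have e : ∀ z, funAct P t (fun z => L⁻¹ * f z) z = L⁻¹ * funAct P t f z := by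
    intro z; exact integral_const_mul _ _
  rw [e, e, ← mul_sub, abs_mul, abs_of_pos (inv_pos.2 hL)] at h2
  have h3 := mul_le_mul_of_nonneg_left h2 hL.le
  rw [← mul_assoc, mul_inv_cancel₀ hL.ne'] at h3
  linarith

lemma aux_meas_of_lip {f : X → ℝ} {L : ℝ} (hL : 0 < L)
    (hf : ∀ x y, |f x - f y| ≤ L * dist x y) : Measurable f := by
  have : LipschitzWith L.toNNReal f := by
    apply LipschitzWith.of_dist_le_mul
    intro x y
    rw [Real.coe_toNNReal _ hL.le]
    exact hf x y
  exact this.continuous.measurable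

/-- centered averages vanish -/
lemma aux_conv0 {P : ℝ → X → Measure X} (hP : IsMarkovSemigroup P) {γ : ℝ} (hA3 : CondA3 P γ)
    (ν : Measure X) [IsProbabilityMeasure ν] (x₀ : X) {f : X → ℝ} {L C : ℝ} (hL : 0 < L)
    (hf : ∀ x y, |f x - f y| ≤ L * dist x y) (hC : ∀ x, |f x| ≤ C) :
    Tendsto (fun t : ℝ => ∫ x, f x ∂(measAct P t ν) - funAct P t f x₀) atTop (𝓝 0) := by
  have hm := aux_meas_of_lip hL hf
  have h1 : Tendsto (fun t : ℝ => ∫ x, (funAct P t f x - funAct P t f x₀) ∂ν) atTop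
      (𝓝 (∫ _x, (0 : ℝ) ∂ν)) := by
    apply tendsto_integral_filter_of_dominated_convergence (fun _ => C + C)
    · exact Eventually.of_forall fun t =>
        ((aux_funAct_meas hP hm t).sub_const _).aestronglyMeasurable
    · filter_upwards [eventually_ge_atTop (0 : ℝ)] with t ht
      refine Eventually.of_forall fun x => ?_
      exact (norm_sub_le _ _).trans
        (add_le_add (aux_funAct_bdd hP ht hC x) (aux_funAct_bdd hP ht hC x₀))
    · exact integrable_const _
    · refine Eventually.of_forall fun x => ?_
      have hlim : Tendsto (fun t : ℝ => L * Real.exp (-γ * t) * dist x x₀) atTop (𝓝 0) := by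
        have : Tendsto (fun t : ℝ => Real.exp (-γ * t)) atTop (𝓝 0) := by
          apply Real.tendsto_exp_atBot.comp
          exact tendsto_id.const_mul_atTop_of_neg (by linarith [hA3.2.1])
        simpa using (this.const_mul L).mul_const (dist x x₀)
      apply squeeze_zero_norm' _ hlim
      filter_upwards [eventually_ge_atTop (0 : ℝ)] with t ht
      exact aux_contr hP hA3 ht hL hf x x₀
  simp only [integral_zero] at h1
  refine h1.congr' ?_
  filter_upwards [eventually_ge_atTop (0 : ℝ)] with t ht
  rw [aux_integral_measAct hP ν ht hm hC, integral_sub _ (integrable_const _)]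
  · simp
  · exact aux_integrable_bdd _ (aux_funAct_meas hP hm t) (aux_funAct_bdd hP ht hC)

lemma aux_conv {P : ℝ → X → Measure X} (hP : IsMarkovSemigroup P) {γ : ℝ} (hA3 : CondA3 P γ)
    (μ μstar : Measure X) [IsProbabilityMeasure μ] [IsProbabilityMeasure μstar] (x₀ : X)
    (hinv : ∀ t, 0 ≤ t → measAct P t μstar = μstar)
    {f : X → ℝ} {L C : ℝ} (hL : 0 < L)
    (hf : ∀ x y, |f x - f y| ≤ L * dist x y) (hC : ∀ x, |f x| ≤ C) :
    Tendsto (fun t : ℝ => ∫ x, f x ∂(measAct P t μ)) atTop (𝓝 (∫ x, f x ∂μstar)) := by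
  have h1 := aux_conv0 hP hA3 μ x₀ hL hf hC
  have h2 := aux_conv0 hP hA3 μstar x₀ hL hf hC
  have h3 := (h1.sub h2).add_const (∫ x, f x ∂μstar)
  simp only [sub_zero, zero_add] at h3
  refine h3.congr' ?_
  filter_upwards [eventually_ge_atTop (0 : ℝ)] with t ht
  rw [hinv t ht]; ring

/-- uniform first moment bound -/
lemma aux_moment {P : ℝ → X → Measure X} (hP : IsMarkovSemigroup P)
    {μ : Measure X} [IsProbabilityMeasure μ] {x₀ : X} {ζ : ℝ} (hA4 : CondA4 P μ x₀ ζ) :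
    ∃ C1 : ℝ, ∀ t, 0 ≤ t → Integrable (fun x => dist x₀ x) (measAct P t μ) ∧
      ∫ x, dist x₀ x ∂(measAct P t μ) ≤ C1 := by
  obtain ⟨hζ, M, hM⟩ := hA4
  refine ⟨1 + max M 0, fun t ht => ?_⟩
  have := aux_prob hP μ ht
  have hmeas : Measurable (fun x => dist x₀ x) := (continuous_const.dist continuous_id).measurable
  have hle : ∫⁻ x, ENNReal.ofReal (dist x₀ x) ∂(measAct P t μ) ≤ ENNReal.ofReal (1 + max M 0) := by
    calc ∫⁻ x, ENNReal.ofReal (dist x₀ x) ∂(measAct P t μ)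
        ≤ ∫⁻ x, (1 + ENNReal.ofReal (dist x₀ x ^ ζ)) ∂(measAct P t μ) := by
          apply lintegral_mono
          intro x
          have h0 : (0 : ℝ) ≤ dist x₀ x := dist_nonneg
          have : dist x₀ x ≤ 1 + dist x₀ x ^ ζ := by
            by_cases h : dist x₀ x ≤ 1
            · linarith [Real.rpow_nonneg h0 ζ]
            · have := Real.self_le_rpow_of_one_le (not_le.1 h).le (by linarith : 1 ≤ ζ)
              linarith
          calc ENNReal.ofReal (dist x₀ x) ≤ ENNReal.ofReal (1 + dist x₀ x ^ ζ) :=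
                ENNReal.ofReal_le_ofReal this
            _ = _ := by
                rw [ENNReal.ofReal_add zero_le_one (Real.rpow_nonneg h0 ζ), ENNReal.ofReal_one]
      _ = 1 + ∫⁻ x, ENNReal.ofReal (dist x₀ x ^ ζ) ∂(measAct P t μ) := by
          rw [lintegral_add_left measurable_const]; simp
      _ ≤ 1 + ENNReal.ofReal (max M 0) := by
          gcongr
          exact (hM t ht).trans (ENNReal.ofReal_le_ofReal (le_max_left _ _))
      _ = _ := by rw [ENNReal.ofReal_add zero_le_one (le_max_right _ _), ENNReal.ofReal_one]
  have hint : Integrable (fun x => dist x₀ x) (measAct P t μ) := by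
    refine ⟨hmeas.aestronglyMeasurable, ?_⟩
    rw [hasFiniteIntegral_iff_ofReal (Eventually.of_forall fun x => dist_nonneg)]
    exact hle.trans_lt ENNReal.ofReal_lt_top
  refine ⟨hint, ?_⟩
  rw [← ofReal_integral_eq_lintegral_ofReal hint (Eventually.of_forall fun x => dist_nonneg)] at hle
  exact (ENNReal.ofReal_le_ofReal_iff (by positivity)).1 hle

/-- first moment of the invariant measure -/
lemma aux_star_moment {P : ℝ → X → Measure X} (hP : IsMarkovSemigroup P) {γ : ℝ}
    (hA3 : CondA3 P γ)
    {μ μstar : Measure X} [IsProbabilityMeasure μ] [IsProbabilityMeasure μstar] {x₀ : X} {ζ : ℝ}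
    (hA4 : CondA4 P μ x₀ ζ) (hinv : ∀ t, 0 ≤ t → measAct P t μstar = μstar) :
    Integrable (fun x => dist x₀ x) μstar := by
  obtain ⟨C1, hC1⟩ := aux_moment hP hA4
  have hmeas : Measurable (fun x => dist x₀ x) := (continuous_const.dist continuous_id).measurable
  have hb : ∀ n : ℕ, ∀ x, |min (dist x₀ x) (n : ℝ)| ≤ n := by
    intro n x
    rw [abs_of_nonneg (le_min dist_nonneg n.cast_nonneg)]
    exact min_le_right _ _
  have hmn : ∀ n : ℕ, Measurable fun x => min (dist x₀ x) (n : ℝ) :=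
    fun n => hmeas.min measurable_const
  have hn : ∀ n : ℕ, ∫ x, min (dist x₀ x) (n : ℝ) ∂μstar ≤ C1 := by
    intro n
    have hl : ∀ x y, |min (dist x₀ x) (n : ℝ) - min (dist x₀ y) (n : ℝ)| ≤ 1 * dist x y := by
      intro x y
      have h1 := abs_min_sub_min_le_max (dist x₀ x) (n : ℝ) (dist x₀ y) n
      rw [sub_self, abs_zero, max_eq_left (abs_nonneg _)] at h1
      refine h1.trans ?_
      rw [one_mul, dist_comm x₀ x, dist_comm x₀ y]
      exact abs_dist_sub_le x y x₀
    refine le_of_tendsto (aux_conv hP hA3 μ μstar x₀ hinv one_pos hl (hb n)) ?_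
    filter_upwards [eventually_ge_atTop (0 : ℝ)] with t ht
    have := aux_prob hP μ ht
    refine le_trans (integral_mono (aux_integrable_bdd _ (hmn n) (hb n)) (hC1 t ht).1 ?_)
      (hC1 t ht).2
    intro x; exact min_le_left _ _
  refine ⟨hmeas.aestronglyMeasurable, ?_⟩
  rw [hasFiniteIntegral_iff_ofReal (Eventually.of_forall fun x => dist_nonneg)]
  have hlim : ∀ x, Tendsto (fun n : ℕ => ENNReal.ofReal (min (dist x₀ x) (n : ℝ))) atTop
      (𝓝 (ENNReal.ofReal (dist x₀ x))) := by
    intro x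
    apply tendsto_const_nhds.congr'
    obtain ⟨N, hN⟩ := exists_nat_ge (dist x₀ x)
    filter_upwards [eventually_ge_atTop N] with n hnN
    rw [min_eq_left (hN.trans (by exact_mod_cast hnN))]
  refine lt_of_le_of_lt ?_ (ENNReal.ofReal_lt_top (r := C1))
  have h2 : ∫⁻ x, ENNReal.ofReal (dist x₀ x) ∂μstar =
      ∫⁻ x, liminf (fun n : ℕ => ENNReal.ofReal (min (dist x₀ x) (n : ℝ))) atTop ∂μstar := by
    apply lintegral_congr
    intro x; exact (hlim x).liminf_eq.symm
  rw [h2]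
  refine (lintegral_liminf_le fun n => (hmn n).ennreal_ofReal).trans ?_
  apply liminf_le_of_le
  · isBoundedDefault
  · intro b hb'
    obtain ⟨n, hbn⟩ := hb'.exists
    refine hbn.trans ?_
    rw [← ofReal_integral_eq_lintegral_ofReal (aux_integrable_bdd _ (hmn n) (hb n))
      (Eventually.of_forall fun x => le_min dist_nonneg n.cast_nonneg)]
    exact ENNReal.ofReal_le_ofReal (hn n)

/-- exponential decay of `P_r g` -/
lemma aux_decay {P : ℝ → X → Measure X} (hP : IsMarkovSemigroup P) {γ : ℝ} (hA3 : CondA3 P γ)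
    {μstar : Measure X} [IsProbabilityMeasure μstar] {x₀ : X}
    (hinv : ∀ t, 0 ≤ t → measAct P t μstar = μstar)
    (hV : Integrable (fun x => dist x₀ x) μstar)
    {g : X → ℝ} {L C : ℝ} (hL : 0 < L)
    (hg : ∀ x y, |g x - g y| ≤ L * dist x y) (hC : ∀ x, |g x| ≤ C)
    (hmean : ∫ x, g x ∂μstar = 0) {t : ℝ} (ht : 0 ≤ t) (x : X) :
    |funAct P t g x| ≤ L * Real.exp (-γ * t) * (dist x₀ x + ∫ y, dist x₀ y ∂μstar) := by
  have hm := aux_meas_of_lip hL hg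
  have h0 : ∫ y, funAct P t g y ∂μstar = 0 := by
    rw [← aux_integral_measAct hP μstar ht hm hC, hinv t ht, hmean]
  have e : funAct P t g x = ∫ y, (funAct P t g x - funAct P t g y) ∂μstar := by
    rw [integral_sub (integrable_const _)
      (aux_integrable_bdd _ (aux_funAct_meas hP hm t) (aux_funAct_bdd hP ht hC)), h0]
    simp
  have e2 : L * Real.exp (-γ * t) * (dist x₀ x + ∫ y, dist x₀ y ∂μstar) =
      ∫ y, L * Real.exp (-γ * t) * (dist x₀ x + dist x₀ y) ∂μstar := by
    rw [integral_const_mul, integral_add (integrable_const _) hV]; simp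
  rw [e, e2, ← Real.norm_eq_abs]
  refine norm_integral_le_of_norm_le (((integrable_const (dist x₀ x)).add hV).const_mul _)
    (Eventually.of_forall fun y => ?_)
  refine (aux_contr hP hA3 ht hL hg x y).trans ?_
  have : dist x y ≤ dist x₀ x + dist x₀ y := dist_triangle_left _ _ _
  have : 0 < L * Real.exp (-γ * t) := by positivity
  gcongr

/-- two-point correlations through the Markov property -/
lemma aux_markov {P : ℝ → X → Measure X} (hP : IsMarkovSemigroup P) {μ : Measure X}
    {ℙ : Measure Ω} [IsProbabilityMeasure ℙ] {Φ : ℝ → Ω → X} (hΦ : IsMarkovProcess P Φ ℙ μ)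
    {g : X → ℝ} (hm : Measurable g) {C : ℝ} (hC : ∀ x, |g x| ≤ C)
    {s r : ℝ} (hs : 0 ≤ s) (hr : 0 ≤ r) :
    ∫ ω, g (Φ s ω) * g (Φ (s + r) ω) ∂ℙ = ∫ x, g x * funAct P r g x ∂(measAct P s μ) := by
  have hΦm : ∀ u, Measurable (Φ u) := fun u =>
    hΦ.jointMeas.comp (measurable_const.prodMk measurable_id)
  have hle : natFiltration Φ s ≤ ‹MeasurableSpace Ω› := by
    refine iSup₂_le fun u _ => (hΦm u).comap_le
  have hsm : StronglyMeasurable[natFiltration Φ s] (fun ω => g (Φ s ω)) := by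
    apply Measurable.stronglyMeasurable
    refine hm.comp ?_
    have h1 : MeasurableSpace.comap (Φ s) inferInstance ≤ natFiltration Φ s :=
      le_iSup₂_of_le (f := fun u (_ : u ∈ Set.Icc (0 : ℝ) s) =>
        MeasurableSpace.comap (Φ u) inferInstance) s ⟨hs, le_rfl⟩ le_rfl
    exact Measurable.mono (comap_measurable (Φ s)) h1 le_rfl
  have hint : Integrable (fun ω => g (Φ (s + r) ω)) ℙ :=
    aux_integrable_bdd _ (hm.comp (hΦm _)) (fun ω => hC _)
  have h1 := condExp_stronglyMeasurable_mul_of_bound hle hsm hint C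
    (Eventually.of_forall fun ω => hC _)
  have h2 := hΦ.markov g hm ⟨C, hC⟩ s r hs hr
  have h3 : ∫ ω, g (Φ s ω) * g (Φ (s + r) ω) ∂ℙ =
      ∫ ω, g (Φ s ω) * funAct P r g (Φ s ω) ∂ℙ := by
    rw [← integral_condExp hle]
    apply integral_congr_ae
    filter_upwards [h1, h2] with ω h1 h2
    rw [h2]
    exact h1
  rw [h3, ← hΦ.law s hs, integral_map (hΦm s).aemeasurable]
  exact (hm.mul (aux_funAct_meas hP hm r)).aestronglyMeasurable

/-- second moment of an integral through the correlation function -/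
lemma aux_second_moment {ℙ : Measure Ω} [IsProbabilityMeasure ℙ] {Z : ℝ → Ω → ℝ}
    (hZ : Measurable fun p : ℝ × Ω => Z p.1 p.2) {C : ℝ} (hC : ∀ s ω, |Z s ω| ≤ C)
    {t : ℝ} (ht : 0 < t) :
    (∫ ω, (∫ s in (0 : ℝ)..t, Z s ω) ^ 2 ∂ℙ) / t =
      2 * ∫ u in Ioc (0 : ℝ) 1, ∫ r in Ioi (0 : ℝ),
        (if t * u + r ≤ t then ∫ ω, Z (t * u) ω * Z (t * u + r) ω ∂ℙ else 0) := by
  set B : ℝ → ℝ → ℝ := fun s s' => ∫ ω, Z s ω * Z s' ω ∂ℙ with hB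
  set ν : Measure ℝ := volume.restrict (Ioc (0 : ℝ) t) with hν
  have hC0 : ∀ ω : Ω, 0 ≤ C := fun ω => (abs_nonneg _).trans (hC 0 ω)
  have hmul : ∀ s s' ω, |Z s ω * Z s' ω| ≤ C * C := by
    intro s s' ω
    rw [abs_mul]
    exact mul_le_mul (hC s ω) (hC s' ω) (abs_nonneg _) (hC0 ω)
  have hZZ : Measurable fun q : (ℝ × ℝ) × Ω => Z q.1.1 q.2 * Z q.1.2 q.2 :=
    (hZ.comp (measurable_fst.fst.prodMk measurable_snd)).mul
      (hZ.comp (measurable_fst.snd.prodMk measurable_snd))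
  have hBm : Measurable fun p : ℝ × ℝ => B p.1 p.2 :=
    (StronglyMeasurable.integral_prod_right
      (f := fun (p : ℝ × ℝ) ω => Z p.1 ω * Z p.2 ω) hZZ.stronglyMeasurable).measurable
  have hBb : ∀ s s', |B s s'| ≤ C * C := by
    intro s s'
    have := norm_integral_le_of_norm_le_const (μ := ℙ) (f := fun ω => Z s ω * Z s' ω) (C := C * C)
      (Eventually.of_forall (hmul s s'))
    simpa using this
  have hBsymm : ∀ s s', B s s' = B s' s := by
    intro s s'
    simp only [hB, mul_comm]
  -- step 1
  have h1 : ∫ ω, (∫ s in (0 : ℝ)..t, Z s ω) ^ 2 ∂ℙ = ∫ p, B p.1 p.2 ∂(ν.prod ν) := by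
    have e : ∀ ω, (∫ s in (0 : ℝ)..t, Z s ω) ^ 2 = ∫ p : ℝ × ℝ, Z p.1 ω * Z p.2 ω ∂(ν.prod ν) := by
      intro ω
      rw [intervalIntegral.integral_of_le ht.le, sq]
      exact (integral_prod_mul (μ := ν) (ν := ν) (fun s => Z s ω) (fun s => Z s ω)).symm
    simp_rw [e]
    rw [integral_integral_swap]
    exact aux_integrable_bdd (C := C * C) _ (hZZ.comp measurable_swap) (fun q => hmul _ _ _)
  -- step 2
  set H : ℝ × ℝ → ℝ := fun p => if p.1 < p.2 then B p.1 p.2 else 0 with hH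
  have hHm : Measurable H :=
    Measurable.ite (measurableSet_lt measurable_fst measurable_snd) hBm measurable_const
  have hHb : ∀ p, |H p| ≤ C * C := by
    intro p
    simp only [hH]
    split_ifs
    · exact hBb _ _
    · simpa using (abs_nonneg _).trans (hBb 0 0)
  have hHi : Integrable H (ν.prod ν) := aux_integrable_bdd _ hHm hHb
  have hHi' : Integrable (fun p : ℝ × ℝ => H p.swap) (ν.prod ν) :=
    aux_integrable_bdd _ (hHm.comp measurable_swap) (fun p => hHb _)
  have hdiag : ∀ᵐ p : ℝ × ℝ ∂(ν.prod ν), p.1 ≠ p.2 := by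
    rw [ae_iff]
    simp only [ne_eq, not_not]
    have hms : MeasurableSet {p : ℝ × ℝ | p.1 = p.2} :=
      measurableSet_eq_fun measurable_fst measurable_snd
    rw [Measure.measure_prod_null hms]
    refine Eventually.of_forall fun x => ?_
    have : Prod.mk x ⁻¹' {p : ℝ × ℝ | p.1 = p.2} = {x} := by
      ext y; simp [eq_comm]
    simp only [this]
    simp
  have h2 : ∫ p, B p.1 p.2 ∂(ν.prod ν) = 2 * ∫ p, H p ∂(ν.prod ν) := by
    have e : ∫ p, B p.1 p.2 ∂(ν.prod ν) = ∫ p : ℝ × ℝ, (H p + H p.swap) ∂(ν.prod ν) := by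
      apply integral_congr_ae
      filter_upwards [hdiag] with p hp
      simp only [hH, Prod.fst_swap, Prod.snd_swap]
      rcases lt_or_gt_of_ne hp with h | h
      · rw [if_pos h, if_neg h.not_gt, add_zero]
      · rw [if_neg h.not_gt, if_pos h, zero_add, hBsymm]
    rw [e, integral_add hHi hHi', integral_prod_swap]
    ring
  -- step 3
  set G : ℝ → ℝ := fun s => ∫ r in Ioi (0 : ℝ), (if s + r ≤ t then B s (s + r) else 0) with hG
  have h3 : ∫ p, H p ∂(ν.prod ν) = ∫ s in Ioc (0 : ℝ) t, G s := by
    rw [integral_prod _ hHi]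
    apply setIntegral_congr_fun measurableSet_Ioc
    intro s hs
    simp only [hG, hν]
    rw [← integral_indicator measurableSet_Ioc, ← integral_indicator measurableSet_Ioi,
      ← integral_add_left_eq_self _ s]
    congr 1
    ext r
    simp only [indicator, hH, mem_Ioc, mem_Ioi]
    by_cases hr : 0 < r
    · have : 0 < s + r := by linarith [hs.1]
      simp [hr, this]
    · simp [hr]
  -- step 4
  have h4 : ∫ s in Ioc (0 : ℝ) t, G s = t * ∫ u in Ioc (0 : ℝ) 1, G (t * u) := by
    rw [← intervalIntegral.integral_of_le ht.le, ← intervalIntegral.integral_of_le zero_le_one]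
    simp
  rw [h1, h2, h3, h4, mul_left_comm, mul_div_cancel_left₀ _ ht.ne']

end aux

/-- Section 5. Under (A2)–(A4), `E_μ[I_t(g)²]/t → 2∫ g χ_g dμ_*`
as `t → ∞`. -/
theorem asymptotic_variance_representation
    (P : ℝ → X → Measure X) (hP : IsMarkovSemigroup P)
    (γ ζ : ℝ) (x₀ : X) (μ μstar : Measure X)
    [IsProbabilityMeasure μ] [IsProbabilityMeasure μstar]
    (hA2 : CondA2 P) (hA3 : CondA3 P γ) (hA4 : CondA4 P μ x₀ ζ)
    (hinv : ∀ t, 0 ≤ t → measAct P t μstar = μstar)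
    (g : X → ℝ) (K : ℝ≥0) (hLip : LipschitzWith K g) (hBd : ∃ C, ∀ x, |g x| ≤ C)
    (hmean : ∫ x, g x ∂μstar = 0)
    (ℙμ : Measure Ω) [IsProbabilityMeasure ℙμ]
    (Φ : ℝ → Ω → X) (hΦ : IsMarkovProcess P Φ ℙμ μ) :
    Tendsto (fun t : ℝ => (∫ ω, (addFun g Φ t ω) ^ 2 ∂ℙμ) / t)
      atTop (𝓝 (2 * ∫ x, g x * corrector P g x ∂μstar)) := by
  obtain ⟨C, hC⟩ := hBd
  set L : ℝ := (K : ℝ) + 1 with hLdef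
  have hL : 0 < L := by positivity
  have hg : ∀ x y, |g x - g y| ≤ L * dist x y := by
    intro x y
    refine (hLip.dist_le_mul x y).trans ?_
    gcongr
    linarith
  have hm : Measurable g := hLip.continuous.measurable
  have hγ := hA3.2.1
  have hC0 : 0 ≤ C := (abs_nonneg _).trans (hC x₀)
  have hV := aux_star_moment hP hA3 hA4 hinv
  obtain ⟨C1, hC1⟩ := aux_moment hP hA4
  set c := ∫ y, dist x₀ y ∂μstar with hc
  have hdec := fun (t : ℝ) (ht : 0 ≤ t) x => aux_decay hP hA3 hinv hV hL hg hC hmean ht x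
  have hZ : Measurable fun p : ℝ × Ω => g (Φ p.1 p.2) := hm.comp hΦ.jointMeas
  -- correlation function
  set A : ℝ → ℝ → ℝ := fun s r => ∫ ω, g (Φ s ω) * g (Φ (s + r) ω) ∂ℙμ with hA
  have hAmeas : Measurable fun p : ℝ × ℝ => A p.1 p.2 := by
    apply StronglyMeasurable.measurable
    apply StronglyMeasurable.integral_prod_right
      (f := fun (p : ℝ × ℝ) ω => g (Φ p.1 ω) * g (Φ (p.1 + p.2) ω))
    apply Measurable.stronglyMeasurable
    apply Measurable.mul
    · exact hZ.comp (measurable_fst.fst.prodMk measurable_snd)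
    · exact hZ.comp ((measurable_fst.fst.add measurable_fst.snd).prodMk measurable_snd)
  set D : ℝ := C * L * (C1 + c) with hD
  have hAbd : ∀ s r, 0 ≤ s → 0 ≤ r → |A s r| ≤ D * Real.exp (-γ * r) := by
    intro s r hs hr
    have := aux_prob hP μ hs
    obtain ⟨hi, hle⟩ := hC1 s hs
    simp only [hA]
    rw [aux_markov hP hΦ hm hC hs hr]
    have h1 : |∫ x, g x * funAct P r g x ∂(measAct P s μ)| ≤
        ∫ x, C * L * Real.exp (-γ * r) * (dist x₀ x + c) ∂(measAct P s μ) := by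
      rw [← Real.norm_eq_abs]
      refine norm_integral_le_of_norm_le
        (((hi.add (integrable_const c)).const_mul (C * L * Real.exp (-γ * r))))
        (Eventually.of_forall fun x => ?_)
      rw [Real.norm_eq_abs, abs_mul]
      have := mul_le_mul (hC x) (hdec r hr x) (abs_nonneg _) hC0
      linarith
    refine h1.trans ?_
    rw [integral_const_mul, integral_add hi (integrable_const c)]
    simp only [integral_const, probReal_univ, one_smul]
    have : C * L * Real.exp (-γ * r) * (∫ x, dist x₀ x ∂(measAct P s μ) + c) ≤
        C * L * Real.exp (-γ * r) * (C1 + c) := by gcongr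
    rw [hD]; linarith
  have hAlim : ∀ r, 0 ≤ r → Tendsto (fun s => A s r) atTop
      (𝓝 (∫ x, g x * funAct P r g x ∂μstar)) := by
    intro r hr
    have hl : ∀ x y, |g x * funAct P r g x - g y * funAct P r g y| ≤
        (C * L + L * C + 1) * dist x y := by
      intro x y
      have h1 := aux_contr hP hA3 hr hL hg x y
      have h1' : |funAct P r g x - funAct P r g y| ≤ L * dist x y := by
        refine h1.trans ?_
        have : Real.exp (-γ * r) ≤ 1 := by
          rw [Real.exp_le_one_iff]; nlinarith
        have : L * Real.exp (-γ * r) ≤ L * 1 := by gcongr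
        rw [mul_one] at this
        gcongr
      have e : g x * funAct P r g x - g y * funAct P r g y =
        g x * (funAct P r g x - funAct P r g y) + (g x - g y) * funAct P r g y := by ring
      rw [e]
      refine (abs_add_le _ _).trans ?_
      rw [abs_mul, abs_mul]
      have h2 := mul_le_mul (hC x) h1' (abs_nonneg _) hC0
      have h3 := mul_le_mul (hg x y) (aux_funAct_bdd hP hr hC y) (abs_nonneg _)
        (by positivity)
      have : (0 : ℝ) ≤ dist x y := dist_nonneg
      linarith
    have hb : ∀ x, |g x * funAct P r g x| ≤ C * C := by
      intro x
      rw [abs_mul]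
      exact mul_le_mul (hC x) (aux_funAct_bdd hP hr hC x) (abs_nonneg _) hC0
    refine (aux_conv hP hA3 μ μstar x₀ hinv (by positivity) hl hb).congr' ?_
    filter_upwards [eventually_ge_atTop (0 : ℝ)] with s hs
    simp only [hA]
    rw [aux_markov hP hΦ hm hC hs hr]
  have hexp : IntegrableOn (fun r : ℝ => Real.exp (-γ * r)) (Ioi 0) :=
    integrableOn_exp_mul_Ioi (by linarith) 0
  -- the right-hand side
  have hrhs : ∫ x, g x * corrector P g x ∂μstar =
      ∫ r in Ioi (0 : ℝ), ∫ x, g x * funAct P r g x ∂μstar := by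
    have h1 : ∀ x, g x * corrector P g x = ∫ r in Ioi (0 : ℝ), g x * funAct P r g x := by
      intro x; rw [corrector, integral_const_mul]
    simp_rw [h1]
    apply integral_integral_swap
    have hdom : Integrable (fun p : X × ℝ => (C * L * (dist x₀ p.1 + c)) * Real.exp (-γ * p.2))
        (μstar.prod (volume.restrict (Ioi (0 : ℝ)))) :=
      Integrable.mul_prod ((hV.add (integrable_const c)).const_mul (C * L)) hexp
    refine hdom.mono' ?_ ?_
    · apply Measurable.aestronglyMeasurable
      exact (hm.comp measurable_fst).mul ((aux_funAct_joint hP hm).comp measurable_swap)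
    · have hae : ∀ᵐ p : X × ℝ ∂(μstar.prod (volume.restrict (Ioi (0 : ℝ)))), p.2 ∈ Ioi (0 : ℝ) :=
        Measure.quasiMeasurePreserving_snd.ae (ae_restrict_mem measurableSet_Ioi)
      filter_upwards [hae] with p hp
      have hp' : 0 ≤ p.2 := le_of_lt hp
      simp only [Function.uncurry]
      rw [Real.norm_eq_abs, abs_mul]
      have := mul_le_mul (hC p.1) (hdec p.2 hp' p.1) (abs_nonneg _) hC0
      linarith
  rw [hrhs]
  have hmain : Tendsto (fun t : ℝ => ∫ u in Ioc (0 : ℝ) 1, ∫ r in Ioi (0 : ℝ),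
        (if t * u + r ≤ t then A (t * u) r else 0)) atTop
      (𝓝 (∫ _u in Ioc (0 : ℝ) 1, ∫ r in Ioi (0 : ℝ), ∫ x, g x * funAct P r g x ∂μstar)) := by
    have hFm : ∀ t : ℝ, Measurable fun p : ℝ × ℝ =>
        (if t * p.1 + p.2 ≤ t then A (t * p.1) p.2 else 0) := by
      intro t
      refine Measurable.ite ?_ ?_ measurable_const
      · exact measurableSet_le (by fun_prop) (by fun_prop)
      · exact hAmeas.comp ((measurable_fst.const_mul t).prodMk measurable_snd)
    have hFb : ∀ t u r : ℝ, 0 ≤ t → 0 ≤ u → 0 ≤ r →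
        ‖(if t * u + r ≤ t then A (t * u) r else 0)‖ ≤ D * Real.exp (-γ * r) := by
      intro t u r ht hu hr
      have := hAbd (t * u) r (mul_nonneg ht hu) hr
      split_ifs
      · exact this
      · simpa using (abs_nonneg _).trans this
    apply tendsto_integral_filter_of_dominated_convergence
      (fun _ => ∫ r in Ioi (0 : ℝ), D * Real.exp (-γ * r))
    · refine Eventually.of_forall fun t => ?_
      exact (StronglyMeasurable.integral_prod_right
        (f := fun u r : ℝ => (if t * u + r ≤ t then A (t * u) r else 0))
        (hFm t).stronglyMeasurable).aestronglyMeasurable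
    · filter_upwards [eventually_ge_atTop (0 : ℝ)] with t ht
      filter_upwards [ae_restrict_mem measurableSet_Ioc] with u hu
      refine norm_integral_le_of_norm_le (hexp.const_mul D) ?_
      filter_upwards [ae_restrict_mem measurableSet_Ioi] with r hr
      exact hFb t u r ht hu.1.le (le_of_lt hr)
    · exact integrable_const _
    · have hne : ∀ᵐ u : ℝ ∂(volume.restrict (Ioc (0 : ℝ) 1)), u ≠ 1 :=
        ae_restrict_of_ae (by simp [ae_iff])
      filter_upwards [ae_restrict_mem measurableSet_Ioc, hne] with u hu hu1
      have hu1' : u < 1 := lt_of_le_of_ne hu.2 hu1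
      apply tendsto_integral_filter_of_dominated_convergence
        (fun r => D * Real.exp (-γ * r))
      · refine Eventually.of_forall fun t => ?_
        exact ((hFm t).comp (measurable_const.prodMk measurable_id)).aestronglyMeasurable
      · filter_upwards [eventually_ge_atTop (0 : ℝ)] with t ht
        filter_upwards [ae_restrict_mem measurableSet_Ioi] with r hr
        exact hFb t u r ht hu.1.le (le_of_lt hr)
      · exact hexp.const_mul D
      · filter_upwards [ae_restrict_mem measurableSet_Ioi] with r hr
        have h1 := (hAlim r (le_of_lt hr)).comp (tendsto_id.atTop_mul_const hu.1)
        refine h1.congr' ?_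
        filter_upwards [eventually_ge_atTop (r / (1 - u))] with t ht
        rw [div_le_iff₀ (by linarith)] at ht
        rw [if_pos (by linarith)]
        simp [mul_comm]
  have hconst : (∫ _u in Ioc (0 : ℝ) 1, ∫ r in Ioi (0 : ℝ), ∫ x, g x * funAct P r g x ∂μstar) =
      ∫ r in Ioi (0 : ℝ), ∫ x, g x * funAct P r g x ∂μstar := by
    simp
  rw [hconst] at hmain
  refine (hmain.const_mul 2).congr' ?_
  filter_upwards [eventually_gt_atTop (0 : ℝ)] with t ht
  have := aux_second_moment (ℙ := ℙμ) (Z := fun s ω => g (Φ s ω)) hZ (fun s ω => hC _) ht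
  simp only [addFun]
  rw [this]

end
end

section
/- Assume conditions (A2)–(A4). Then the semigroup {P_t}_{t≥0} is weak-* mean ergodic: for every Borel probability measure ν on X and every bounded continuous f : X → ℝ, (1/t) ∫_0^t (∫_X f d(νP_s)) ds → ∫_X f dμ_* as t → ∞. -/
open MeasureTheory Filter Set
open scoped ENNReal Topology NNReal

noncomputable section

variable {X : Type*} [MetricSpace X] [CompleteSpace X] [SecondCountableTopology X]
  [MeasurableSpace X] [BorelSpace X]

variable {Ω : Type*} [MeasurableSpace Ω]

/-- The joint kernel `(s, x) ↦ P s x`. -/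
def jointKer (P : ℝ → X → Measure X) (hP : IsMarkovSemigroup P) :
    ProbabilityTheory.Kernel (ℝ × X) X where
  toFun p := P p.1 p.2
  measurable' := Measure.measurable_of_measurable_coe _ (fun A hA => hP.jointMeas A hA)

/-- The kernel `x ↦ P t x`. -/
def timeKer (P : ℝ → X → Measure X) (hP : IsMarkovSemigroup P) (t : ℝ) :
    ProbabilityTheory.Kernel X X where
  toFun x := P t x
  measurable' := (jointKer P hP).measurable.comp (measurable_const.prodMk measurable_id)

theorem funAct_joint_meas (P : ℝ → X → Measure X) (hP : IsMarkovSemigroup P)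
    (f : X → ℝ) (hf : Continuous f) :
    StronglyMeasurable (fun p : ℝ × X => funAct P p.1 f p.2) :=
  (hf.stronglyMeasurable).integral_kernel (κ := jointKer P hP)

theorem funAct_meas (P : ℝ → X → Measure X) (hP : IsMarkovSemigroup P)
    (f : X → ℝ) (hf : Continuous f) (t : ℝ) :
    StronglyMeasurable (funAct P t f) :=
  (hf.stronglyMeasurable).integral_kernel (κ := timeKer P hP t)

theorem funAct_bound (P : ℝ → X → Measure X) (hP : IsMarkovSemigroup P)
    (f : X → ℝ) (C : ℝ) (hC : ∀ x, |f x| ≤ C) (t : ℝ) (ht : 0 ≤ t) (x : X) :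
    |funAct P t f x| ≤ C := by
  have := hP.prob t ht x
  have h := norm_integral_le_of_norm_le_const (μ := P t x) (f := f) (C := C)
    (Eventually.of_forall hC)
  simpa [funAct] using h

theorem measAct_prob (P : ℝ → X → Measure X) (hP : IsMarkovSemigroup P)
    (t : ℝ) (ht : 0 ≤ t) (ν : Measure X) [IsProbabilityMeasure ν] :
    IsProbabilityMeasure (measAct P t ν) := by
  have : ProbabilityTheory.IsMarkovKernel (timeKer P hP t) := ⟨fun x => hP.prob t ht x⟩
  exact (inferInstance : IsProbabilityMeasure (ν.bind (timeKer P hP t)))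

theorem integral_measAct (P : ℝ → X → Measure X) (hP : IsMarkovSemigroup P)
    (f : X → ℝ) (hf : Continuous f) (C : ℝ) (hC : ∀ x, |f x| ≤ C) (t : ℝ) (ht : 0 ≤ t)
    (ν : Measure X) [IsProbabilityMeasure ν] :
    ∫ x, f x ∂(measAct P t ν) = ∫ x, funAct P t f x ∂ν := by
  have := measAct_prob P hP t ht ν
  have hint : Integrable f (measAct P t ν) :=
    Integrable.of_bound hf.aestronglyMeasurable C (Eventually.of_forall hC)
  exact ProbabilityTheory.Kernel.integral_comp (η := timeKer P hP t)
    (κ := ProbabilityTheory.Kernel.const Unit ν) (a := ()) hint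

theorem ffm (P : ℝ → X → Measure X) (hP : IsMarkovSemigroup P) (γ : ℝ)
    (hA3 : CondA3 P γ) (t : ℝ) (ht : 0 < t) (x z : X) :
    Integrable (fun y => dist z y) (P t x) := by
  have h := hA3.1 (Measure.dirac x) inferInstance
    (fun w => integrable_dirac (by simp)) t ht
  have e : measAct P t (Measure.dirac x) = P t x :=
    Measure.dirac_bind (timeKer P hP t).measurable x
  rw [e] at h
  exact h z

theorem wass_lip (P : ℝ → X → Measure X) (hP : IsMarkovSemigroup P) (γ : ℝ)
    (hA3 : CondA3 P γ) (t : ℝ) (ht : 0 < t) (x y : X) (f : X → ℝ) (hf : LipschitzWith 1 f) :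
    |funAct P t f x - funAct P t f y| ≤ Real.exp (-γ * t) * dist x y := by
  have key : ∀ (w : X) (g : X → ℝ), LipschitzWith 1 g →
      |(∫ u, g u ∂(P t w)) - g x| ≤ ∫ u, dist x u ∂(P t w) := by
    intro w g hg
    have := hP.prob t ht.le w
    have hd := ffm P hP γ hA3 t ht w x
    have hb : ∀ u, ‖g u - g x‖ ≤ dist x u := fun u => by
      have := hg.dist_le_mul u x
      rw [Real.dist_eq] at this
      rw [Real.norm_eq_abs, dist_comm x u]
      simpa using this
    have hi : Integrable (fun u => g u - g x) (P t w) :=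
      hd.mono' (hg.continuous.sub continuous_const).aestronglyMeasurable (Eventually.of_forall hb)
    have hg' : Integrable g (P t w) := by
      have := hi.add (integrable_const (g x))
      refine this.congr (Eventually.of_forall fun u => by simp)
    have e : (∫ u, g u ∂(P t w)) - g x = ∫ u, (g u - g x) ∂(P t w) := by
      rw [integral_sub hg' (integrable_const _)]; simp
    rw [e]
    exact norm_integral_le_of_norm_le hd (Eventually.of_forall hb)
  refine le_trans ?_ (hA3.2.2 t ht.le x y)
  refine le_csSup ⟨(∫ u, dist x u ∂(P t x)) + ∫ u, dist x u ∂(P t y), ?_⟩ ⟨f, hf, rfl⟩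
  rintro r ⟨g, hg, rfl⟩
  have h1 := abs_le.1 (key x g hg)
  have h2 := abs_le.1 (key y g hg)
  rw [abs_le]
  constructor <;> linarith

theorem funAct_lip (P : ℝ → X → Measure X) (hP : IsMarkovSemigroup P) (γ : ℝ)
    (hA3 : CondA3 P γ) (t : ℝ) (ht : 0 < t) (x y : X) (f : X → ℝ) (L : ℝ≥0)
    (hf : LipschitzWith L f) :
    |funAct P t f x - funAct P t f y| ≤ (L + 1) * (Real.exp (-γ * t) * dist x y) := by
  have hL : (0 : ℝ) < L + 1 := by positivity
  have hg : LipschitzWith 1 (fun u => ((L : ℝ) + 1)⁻¹ * f u) := by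
    refine LipschitzWith.of_dist_le_mul fun u v => ?_
    have h := hf.dist_le_mul u v
    rw [Real.dist_eq] at h ⊢
    rw [← mul_sub, abs_mul, abs_of_pos (inv_pos.2 hL), inv_mul_le_iff₀ hL]
    have := dist_nonneg (x := u) (y := v)
    push_cast
    nlinarith
  have h := wass_lip P hP γ hA3 t ht x y _ hg
  simp only [funAct, integral_const_mul] at h ⊢
  rw [← mul_sub, abs_mul, abs_of_pos (inv_pos.2 hL), inv_mul_le_iff₀ hL] at h
  exact h

theorem tendsto_funAct (P : ℝ → X → Measure X) (hP : IsMarkovSemigroup P) (γ : ℝ)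
    (hA3 : CondA3 P γ) (μstar : Measure X) [IsProbabilityMeasure μstar]
    (hinv : ∀ t, 0 ≤ t → measAct P t μstar = μstar)
    (f : X → ℝ) (L : ℝ≥0) (hf : LipschitzWith L f) (C : ℝ) (hC : ∀ x, |f x| ≤ C) (x : X) :
    Tendsto (fun t => funAct P t f x) atTop (𝓝 (∫ y, f y ∂μstar)) := by
  have h0 : Tendsto (fun t => ∫ y, (funAct P t f x - funAct P t f y) ∂μstar) atTop
      (𝓝 (∫ _y, (0 : ℝ) ∂μstar)) := by
    refine tendsto_integral_filter_of_dominated_convergence (fun _ => C + C) ?_ ?_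
      (integrable_const _) ?_
    · exact Eventually.of_forall fun t =>
        (stronglyMeasurable_const.sub (funAct_meas P hP f hf.continuous t)).aestronglyMeasurable
    · filter_upwards [eventually_ge_atTop 0] with t ht
      refine Eventually.of_forall fun y => ?_
      exact (norm_sub_le _ _).trans (add_le_add (funAct_bound P hP f C hC t ht x)
        (funAct_bound P hP f C hC t ht y))
    · refine Eventually.of_forall fun y => ?_
      have he : Tendsto (fun t : ℝ => (L + 1 : ℝ) * (Real.exp (-γ * t) * dist x y)) atTop (𝓝 0) := by
        have h1 : Tendsto (fun t : ℝ => -γ * t) atTop atBot :=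
          tendsto_id.const_mul_atTop_of_neg (by linarith [hA3.2.1])
        have h2 := Real.tendsto_exp_atBot.comp h1
        simpa using (h2.mul_const (dist x y)).const_mul (L + 1 : ℝ)
      refine squeeze_zero_norm' ?_ he
      filter_upwards [eventually_gt_atTop 0] with t ht
      exact funAct_lip P hP γ hA3 t ht x y f L hf
  simp only [integral_zero] at h0
  have h1 := h0.add_const (∫ y, f y ∂μstar)
  rw [zero_add] at h1
  refine h1.congr' ?_
  filter_upwards [eventually_ge_atTop 0] with t ht
  have hi : Integrable (funAct P t f) μstar :=
    Integrable.of_bound (funAct_meas P hP f hf.continuous t).aestronglyMeasurable C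
      (Eventually.of_forall (funAct_bound P hP f C hC t ht))
  have e := integral_measAct P hP f hf.continuous C hC t ht μstar
  rw [hinv t ht] at e
  rw [integral_sub (integrable_const _) hi, e]
  simp

theorem tendsto_measAct (P : ℝ → X → Measure X) (hP : IsMarkovSemigroup P) (γ : ℝ)
    (hA3 : CondA3 P γ) (μstar : Measure X) [IsProbabilityMeasure μstar]
    (hinv : ∀ t, 0 ≤ t → measAct P t μstar = μstar)
    (ν : Measure X) [IsProbabilityMeasure ν]
    (f : X → ℝ) (hf : Continuous f) (C : ℝ) (hC : ∀ x, |f x| ≤ C) :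
    Tendsto (fun t => ∫ x, f x ∂(measAct P t ν)) atTop (𝓝 (∫ y, f y ∂μstar)) := by
  have hpr : ∀ t : ℝ, IsProbabilityMeasure (measAct P (max t 0) ν) := fun t =>
    measAct_prob P hP _ (le_max_right _ _) ν
  have ne : Nonempty X := by
    by_contra h
    rw [not_nonempty_iff] at h
    exact IsProbabilityMeasure.ne_zero ν (Subsingleton.elim _ _)
  let ρs : ℝ → ProbabilityMeasure X := fun t => ⟨measAct P (max t 0) ν, hpr t⟩
  let ρ : ProbabilityMeasure X := ⟨μstar, inferInstance⟩
  have hT : Tendsto ρs atTop (𝓝 ρ) := by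
    rw [tendsto_iff_forall_lipschitz_integral_tendsto]
    rintro g ⟨D, hD⟩ ⟨L, hL⟩
    obtain ⟨z⟩ := ne
    have hB : ∀ x, |g x| ≤ D + |g z| := fun x => by
      have h := hD x z
      rw [Real.dist_eq] at h
      have := abs_add_le (g x - g z) (g z)
      rw [sub_add_cancel] at this
      linarith
    have h0 : Tendsto (fun t => ∫ x, funAct P t g x ∂ν) atTop
        (𝓝 (∫ _x, (∫ y, g y ∂μstar) ∂ν)) := by
      refine tendsto_integral_filter_of_dominated_convergence (fun _ => D + |g z|) ?_ ?_
        (integrable_const _) ?_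
      · exact Eventually.of_forall fun t =>
          (funAct_meas P hP g hL.continuous t).aestronglyMeasurable
      · filter_upwards [eventually_ge_atTop 0] with t ht
        exact Eventually.of_forall (funAct_bound P hP g _ hB t ht)
      · exact Eventually.of_forall fun x =>
          tendsto_funAct P hP γ hA3 μstar hinv g L hL _ hB x
    simp only [integral_const, probReal_univ, one_smul] at h0
    refine h0.congr' ?_
    filter_upwards [eventually_ge_atTop 0] with t ht
    change _ = ∫ x, g x ∂(measAct P (max t 0) ν)
    rw [max_eq_left ht]
    exact (integral_measAct P hP g hL.continuous _ hB t ht ν).symm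
  rw [ProbabilityMeasure.tendsto_iff_forall_integral_tendsto] at hT
  have h := hT (BoundedContinuousFunction.ofNormedAddCommGroup f hf C hC)
  refine h.congr' ?_
  filter_upwards [eventually_ge_atTop 0] with t ht
  change ∫ x, f x ∂(measAct P (max t 0) ν) = _
  rw [max_eq_left ht]

/-- Remark on weak-* mean ergodicity. Under (A2)–(A4), for every
Borel probability measure `ν` and every bounded continuous `f`,
`(1/t) ∫_0^t (∫ f d(νP_s)) ds → ∫ f dμ_*` as `t → ∞`. -/
theorem weak_star_mean_ergodicity
    (P : ℝ → X → Measure X) (hP : IsMarkovSemigroup P)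
    (γ ζ : ℝ) (x₀ : X) (μ μstar : Measure X)
    [IsProbabilityMeasure μ] [IsProbabilityMeasure μstar]
    (hA2 : CondA2 P) (hA3 : CondA3 P γ) (hA4 : CondA4 P μ x₀ ζ)
    (hinv : ∀ t, 0 ≤ t → measAct P t μstar = μstar) :
    ∀ ν : Measure X, IsProbabilityMeasure ν →
      ∀ f : X → ℝ, Continuous f → (∃ C, ∀ x, |f x| ≤ C) →
        Tendsto (fun t : ℝ => (1 / t) * ∫ s in (0 : ℝ)..t, (∫ x, f x ∂(measAct P s ν)))
          atTop (𝓝 (∫ x, f x ∂μstar)) := by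
  rintro ν hν f hf ⟨C, hC⟩
  have hT := tendsto_measAct P hP γ hA3 μstar hinv ν f hf C hC
  set u : ℝ → ℝ := fun s => ∫ x, funAct P s f x ∂ν with hu
  have hum : StronglyMeasurable u :=
    (funAct_joint_meas P hP f hf).integral_prod_right'
  have hue : ∀ s, 0 ≤ s → ∫ x, f x ∂(measAct P s ν) = u s := fun s hs =>
    integral_measAct P hP f hf C hC s hs ν
  have hub : ∀ s, 0 ≤ s → ‖u s‖ ≤ C := fun s hs => by
    have h := norm_integral_le_of_norm_le_const (μ := ν) (f := funAct P s f) (C := C)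
      (Eventually.of_forall (funAct_bound P hP f C hC s hs))
    simpa [hu] using h
  have huT : Tendsto u atTop (𝓝 (∫ x, f x ∂μstar)) := by
    refine hT.congr' ?_
    filter_upwards [eventually_ge_atTop 0] with t ht using hue t ht
  have hD : Tendsto (fun t : ℝ => ∫ r in (0 : ℝ)..1, u (t * r)) atTop
      (𝓝 (∫ _r in (0 : ℝ)..1, (∫ x, f x ∂μstar))) := by
    refine intervalIntegral.tendsto_integral_filter_of_dominated_convergence (fun _ => C) ?_ ?_
      (by simp) ?_
    · exact Eventually.of_forall fun t =>
        (hum.comp_measurable (measurable_const_mul t)).aestronglyMeasurable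
    · filter_upwards [eventually_ge_atTop 0] with t ht
      refine Eventually.of_forall fun r hr => ?_
      rw [uIoc_of_le zero_le_one] at hr
      exact hub _ (mul_nonneg ht hr.1.le)
    · refine Eventually.of_forall fun r hr => ?_
      rw [uIoc_of_le zero_le_one] at hr
      exact huT.comp (tendsto_id.atTop_mul_const hr.1)
  simp only [intervalIntegral.integral_const, sub_zero, one_smul] at hD
  refine hD.congr' ?_
  filter_upwards [eventually_gt_atTop 0] with t ht
  rw [intervalIntegral.integral_comp_mul_left u ht.ne']
  simp only [mul_zero, mul_one, smul_eq_mul, one_div]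
  congr 1
  refine intervalIntegral.integral_congr fun s hs => ?_
  rw [uIcc_of_le ht.le] at hs
  exact (hue s hs.1).symm

end
end
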